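/- Let H be the group with presentation on five generators A13, A23, B13, B23, B12 subject to the three relations A13·B13 = B13·A13, A23·B23 = B23·A23, and B12·(A13·A23)·B12⁻¹ = A13·A23. Then there is a group isomorphism from H onto the subgroup Ṽ_3 of SG_3 generated by a13 = σ2σ1²σ2⁻¹, a23 = σ2², b13 = σ2σ1τ1σ2⁻¹, b23 = σ2τ2, b12 = σ1τ1, sending A13 ↦ a13, A23 ↦ a23, B13 ↦ b13, B23 ↦ b23, B12 ↦ b12. -/

import Mathlib

/-- Defining relations of the singular braid group `SG₃`, as elements of the free
group on four generators `0 ↦ σ₁`, `1 ↦ σ₂`, `2 ↦ τ₁`, `3 ↦ τ₂`. -/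
def sg3Rels : Set (FreeGroup (Fin 4)) :=
  {FreeGroup.of 0 * FreeGroup.of 2 * (FreeGroup.of 2 * FreeGroup.of 0)⁻¹,
   FreeGroup.of 1 * FreeGroup.of 3 * (FreeGroup.of 3 * FreeGroup.of 1)⁻¹,
   FreeGroup.of 0 * FreeGroup.of 1 * FreeGroup.of 0 *
     (FreeGroup.of 1 * FreeGroup.of 0 * FreeGroup.of 1)⁻¹,
   FreeGroup.of 0 * FreeGroup.of 1 * FreeGroup.of 2 *
     (FreeGroup.of 3 * FreeGroup.of 0 * FreeGroup.of 1)⁻¹,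
   FreeGroup.of 1 * FreeGroup.of 0 * FreeGroup.of 3 *
     (FreeGroup.of 2 * FreeGroup.of 1 * FreeGroup.of 0)⁻¹}

/-- The singular braid group on 3 strands. -/
abbrev SG3 : Type := PresentedGroup sg3Rels

def σ1 : SG3 := PresentedGroup.of 0
def σ2 : SG3 := PresentedGroup.of 1
def τ1 : SG3 := PresentedGroup.of 2
def τ2 : SG3 := PresentedGroup.of 3

def a12 : SG3 := σ1 ^ 2
def a13 : SG3 := σ2 * σ1 ^ 2 * σ2⁻¹
def a23 : SG3 := σ2 ^ 2
def b12 : SG3 := σ1 * τ1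
def b13 : SG3 := σ2 * σ1 * τ1 * σ2⁻¹
def b23 : SG3 := σ2 * τ2

/-- Defining relations of `Ṽ₃` on the generators
`0 ↦ A₁₃`, `1 ↦ A₂₃`, `2 ↦ B₁₃`, `3 ↦ B₂₃`, `4 ↦ B₁₂`. -/
def v3Rels : Set (FreeGroup (Fin 5)) :=
  {FreeGroup.of 0 * FreeGroup.of 2 * (FreeGroup.of 2 * FreeGroup.of 0)⁻¹,
   FreeGroup.of 1 * FreeGroup.of 3 * (FreeGroup.of 3 * FreeGroup.of 1)⁻¹,
   FreeGroup.of 4 * (FreeGroup.of 0 * FreeGroup.of 1) * (FreeGroup.of 4)⁻¹ *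
     (FreeGroup.of 0 * FreeGroup.of 1)⁻¹}

/-- Monomial permutation of `Fin 6 × H`. -/
def mono6 {H : Type} [Group H] (s : Equiv.Perm (Fin 6)) (c : Fin 6 → H) :
    Equiv.Perm (Fin 6 × H) :=
  Equiv.prodShear s (fun i => Equiv.mulLeft (c i))

theorem mono6_apply {H : Type} [Group H] (s : Equiv.Perm (Fin 6)) (c : Fin 6 → H) (i : Fin 6)
    (h : H) : mono6 s c (i, h) = (s i, c i * h) := rfl

theorem mono6_mul {H : Type} [Group H] (s t : Equiv.Perm (Fin 6)) (c d : Fin 6 → H) :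
    mono6 s c * mono6 t d = mono6 (s * t) (fun i => c (t i) * d i) := by
  ext1 ⟨i, h⟩
  simp [mono6_apply, mul_assoc]

def perm1 : Equiv.Perm (Fin 6) :=
  ⟨![1, 0, 3, 2, 5, 4], ![1, 0, 3, 2, 5, 4], by decide, by decide⟩
def perm2 : Equiv.Perm (Fin 6) :=
  ⟨![2, 4, 0, 5, 1, 3], ![2, 4, 0, 5, 1, 3], by decide, by decide⟩

section
variable {H : Type} [Group H]

def S1 (a b : H) : Equiv.Perm (Fin 6 × H) :=
  mono6 perm1 ![1, (a * b)⁻¹, 1, b⁻¹ * a * b, 1, b]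
def S2 (a b : H) : Equiv.Perm (Fin 6 × H) :=
  mono6 perm2 ![1, 1, b, 1, a, (a * b)⁻¹]
def T1 (a b x y z : H) : Equiv.Perm (Fin 6 × H) :=
  mono6 perm1 ![a * b * z, z, b⁻¹ * a⁻¹ * x * b, b⁻¹ * x * b, b⁻¹ * y, y]
def T2 (a b x y z : H) : Equiv.Perm (Fin 6 × H) :=
  mono6 perm2 ![b⁻¹ * y, a⁻¹ * x, y, a * b * z, x, z]

variable (a b x y z : H)

theorem mono6_congr {s t : Equiv.Perm (Fin 6)} {c d : Fin 6 → H} (h : s = t) (h' : ∀ i, c i = d i) :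
    mono6 s c = mono6 t d := by
  rw [h, funext h']

theorem rel1 (hx : a * x = x * a) (hy : b * y = y * b) (hz : z * (a * b) = a * b * z) :
    S1 a b * T1 a b x y z = T1 a b x y z * S1 a b := by
  have hx' : a⁻¹ * x = x * a⁻¹ := ((show Commute a x from hx).inv_left).eq
  have hy' : b⁻¹ * y = y * b⁻¹ := ((show Commute b y from hy).inv_left).eq
  have hz' : z * (a * b)⁻¹ = (a * b)⁻¹ * z := ((show Commute z (a * b) from hz).inv_right).eq
  have hx1 : a⁻¹ * (x * a) = x := by rw [← hx, inv_mul_cancel_left]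
  have hx2 : a⁻¹ * (x * (a * b)) = x * b := by rw [← mul_assoc x, ← hx, mul_assoc, inv_mul_cancel_left]
  have hy1 : b⁻¹ * (y * b) = y := by rw [← hy, inv_mul_cancel_left]
  have hz1 : a * (b * (z * (b⁻¹ * a⁻¹))) = z := by
    rw [← mul_inv_rev, ← mul_assoc, ← mul_assoc, ← hz, mul_inv_cancel_right]
  simp only [S1, T1, mono6_mul]
  refine mono6_congr rfl ?_
  intro i
  fin_cases i <;> simp [perm1, mul_assoc] <;> grind

theorem rel2 (hx : a * x = x * a) (hy : b * y = y * b) (hz : z * (a * b) = a * b * z) :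
    S2 a b * T2 a b x y z = T2 a b x y z * S2 a b := by
  have hx' : a⁻¹ * x = x * a⁻¹ := ((show Commute a x from hx).inv_left).eq
  have hy' : b⁻¹ * y = y * b⁻¹ := ((show Commute b y from hy).inv_left).eq
  have hz' : z * (a * b)⁻¹ = (a * b)⁻¹ * z := ((show Commute z (a * b) from hz).inv_right).eq
  have hx1 : a⁻¹ * (x * a) = x := by rw [← hx, inv_mul_cancel_left]
  have hx2 : a⁻¹ * (x * (a * b)) = x * b := by rw [← mul_assoc x, ← hx, mul_assoc, inv_mul_cancel_left]
  have hy1 : b⁻¹ * (y * b) = y := by rw [← hy, inv_mul_cancel_left]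
  have hz1 : a * (b * (z * (b⁻¹ * a⁻¹))) = z := by
    rw [← mul_inv_rev, ← mul_assoc, ← mul_assoc, ← hz, mul_inv_cancel_right]
  simp only [S2, T2, mono6_mul]
  refine mono6_congr rfl ?_
  intro i
  fin_cases i <;> simp [perm2, mul_assoc] <;> grind

theorem rel3 : S1 a b * S2 a b * S1 a b = S2 a b * S1 a b * S2 a b := by
  simp only [S1, S2, mono6_mul]
  refine mono6_congr (by decide) ?_
  intro i
  fin_cases i <;> simp [perm1, perm2, mul_assoc]

theorem rel4 (hx : a * x = x * a) (hy : b * y = y * b) (hz : z * (a * b) = a * b * z) :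
    S1 a b * S2 a b * T1 a b x y z = T2 a b x y z * S1 a b * S2 a b := by
  have hx' : a⁻¹ * x = x * a⁻¹ := ((show Commute a x from hx).inv_left).eq
  have hy' : b⁻¹ * y = y * b⁻¹ := ((show Commute b y from hy).inv_left).eq
  have hz' : z * (a * b)⁻¹ = (a * b)⁻¹ * z := ((show Commute z (a * b) from hz).inv_right).eq
  have hx1 : a⁻¹ * (x * a) = x := by rw [← hx, inv_mul_cancel_left]
  have hx2 : a⁻¹ * (x * (a * b)) = x * b := by rw [← mul_assoc x, ← hx, mul_assoc, inv_mul_cancel_left]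
  have hy1 : b⁻¹ * (y * b) = y := by rw [← hy, inv_mul_cancel_left]
  have hz1 : a * (b * (z * (b⁻¹ * a⁻¹))) = z := by
    rw [← mul_inv_rev, ← mul_assoc, ← mul_assoc, ← hz, mul_inv_cancel_right]
  simp only [S1, S2, T1, T2, mono6_mul]
  refine mono6_congr (by decide) ?_
  intro i
  fin_cases i <;> simp [perm1, perm2, mul_assoc] <;> grind

theorem rel5 (hx : a * x = x * a) (hy : b * y = y * b) (hz : z * (a * b) = a * b * z) :
    S2 a b * S1 a b * T2 a b x y z = T1 a b x y z * S2 a b * S1 a b := by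
  have hx' : a⁻¹ * x = x * a⁻¹ := ((show Commute a x from hx).inv_left).eq
  have hy' : b⁻¹ * y = y * b⁻¹ := ((show Commute b y from hy).inv_left).eq
  have hz' : z * (a * b)⁻¹ = (a * b)⁻¹ * z := ((show Commute z (a * b) from hz).inv_right).eq
  have hx1 : a⁻¹ * (x * a) = x := by rw [← hx, inv_mul_cancel_left]
  have hx2 : a⁻¹ * (x * (a * b)) = x * b := by rw [← mul_assoc x, ← hx, mul_assoc, inv_mul_cancel_left]
  have hy1 : b⁻¹ * (y * b) = y := by rw [← hy, inv_mul_cancel_left]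
  have hz1 : a * (b * (z * (b⁻¹ * a⁻¹))) = z := by
    rw [← mul_inv_rev, ← mul_assoc, ← mul_assoc, ← hz, mul_inv_cancel_right]
  simp only [S1, S2, T1, T2, mono6_mul]
  refine mono6_congr (by decide) ?_
  intro i
  fin_cases i <;> simp [perm1, perm2, mul_assoc] <;> grind

/-- The values of the monomial representation on the generators of `SG₃`. -/
def actGen : Fin 4 → Equiv.Perm (Fin 6 × H) :=
  ![S1 a b, S2 a b, T1 a b x y z, T2 a b x y z]

theorem actGen_rels (hx : a * x = x * a) (hy : b * y = y * b) (hz : z * (a * b) = a * b * z) :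
    ∀ r ∈ sg3Rels, FreeGroup.lift (actGen a b x y z) r = 1 := by
  intro r hr
  simp only [sg3Rels, Set.mem_insert_iff, Set.mem_singleton_iff] at hr
  rcases hr with rfl | rfl | rfl | rfl | rfl <;>
    simp only [map_mul, map_inv, FreeGroup.lift_apply_of, mul_inv_eq_one]
  · exact rel1 a b x y z hx hy hz
  · exact rel2 a b x y z hx hy hz
  · exact rel3 a b
  · exact rel4 a b x y z hx hy hz
  · exact rel5 a b x y z hx hy hz
end

theorem sg_rel (u v : FreeGroup (Fin 4)) (h : u * v⁻¹ ∈ sg3Rels) :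
    PresentedGroup.mk sg3Rels u = PresentedGroup.mk sg3Rels v := by
  have := PresentedGroup.one_of_mem h
  rwa [map_mul, map_inv, mul_inv_eq_one] at this

theorem sg_rel1 : σ1 * τ1 = τ1 * σ1 := sg_rel _ _ (by simp [sg3Rels])
theorem sg_rel2 : σ2 * τ2 = τ2 * σ2 := sg_rel _ _ (by simp [sg3Rels])
theorem sg_rel3 : σ1 * σ2 * σ1 = σ2 * σ1 * σ2 := sg_rel _ _ (by simp [sg3Rels])
theorem sg_rel4 : σ1 * σ2 * τ1 = τ2 * σ1 * σ2 := sg_rel _ _ (by simp [sg3Rels])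
theorem sg_rel5 : σ2 * σ1 * τ2 = τ1 * σ2 * σ1 := sg_rel _ _ (by simp [sg3Rels])

theorem v_rel (u v : FreeGroup (Fin 5)) (h : u * v⁻¹ ∈ v3Rels) :
    PresentedGroup.mk v3Rels u = PresentedGroup.mk v3Rels v := by
  have := PresentedGroup.one_of_mem h
  rwa [map_mul, map_inv, mul_inv_eq_one] at this

def vGen : Fin 5 → SG3 := ![a13, a23, b13, b23, b12]

theorem c13 : a13 * b13 = b13 * a13 := by
  have h : Commute (σ1 ^ 2) (σ1 * τ1) :=
    ((Commute.refl σ1).mul_right (show Commute σ1 τ1 from sg_rel1)).pow_left 2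
  have h2 := congrArg (fun g => σ2 * g * σ2⁻¹) h.eq
  simpa [a13, b13, mul_assoc] using h2

theorem c23 : a23 * b23 = b23 * a23 :=
  (((Commute.refl σ2).mul_right (show Commute σ2 τ2 from sg_rel2)).pow_left 2).eq

theorem c12 : b12 * (a13 * a23) = a13 * a23 * b12 := by
  have e : a13 * a23 = σ2 * σ1 * (σ1 * σ2) := by simp [a13, a23, pow_two, mul_assoc]
  have h1 : Commute τ1 (σ2 * σ1 * (σ1 * σ2)) := by
    change _ = _
    rw [← mul_assoc, ← mul_assoc τ1, ← sg_rel5, mul_assoc, ← mul_assoc τ2, ← sg_rel4]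
    simp only [mul_assoc]
  have h2 : Commute σ1 (σ2 * σ1 * (σ1 * σ2)) := by
    change _ = _
    calc _ = σ1 * σ2 * σ1 * (σ1 * σ2) := by simp only [mul_assoc]
      _ = σ2 * σ1 * (σ2 * σ1 * σ2) := by rw [sg_rel3]; simp only [mul_assoc]
      _ = _ := by rw [← sg_rel3]; simp only [mul_assoc]
  rw [e]
  exact (h2.mul_left h1).eq

theorem vGen_rels : ∀ r ∈ v3Rels, FreeGroup.lift vGen r = 1 := by
  intro r hr
  simp only [v3Rels, Set.mem_insert_iff, Set.mem_singleton_iff] at hr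
  rcases hr with rfl | rfl | rfl <;>
    simp only [map_mul, map_inv, FreeGroup.lift_apply_of, mul_inv_eq_one]
  · exact c13
  · exact c23
  · rw [mul_inv_eq_iff_eq_mul]
    exact c12

abbrev V3 : Type := PresentedGroup v3Rels

def vHom : V3 →* SG3 := PresentedGroup.toGroup vGen_rels

def vg (i : Fin 5) : V3 := PresentedGroup.of i

theorem v1 : vg 0 * vg 2 = vg 2 * vg 0 := v_rel _ _ (by simp [v3Rels])
theorem v2 : vg 1 * vg 3 = vg 3 * vg 1 := v_rel _ _ (by simp [v3Rels])
theorem v3 : vg 4 * (vg 0 * vg 1) = vg 0 * vg 1 * vg 4 := by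
  rw [← mul_inv_eq_iff_eq_mul]
  exact v_rel _ _ (by simp [v3Rels])

def act : SG3 →* Equiv.Perm (Fin 6 × V3) :=
  PresentedGroup.toGroup (actGen_rels (vg 0) (vg 1) (vg 2) (vg 3) (vg 4) v1 v2 v3)

theorem act_σ1 : act σ1 = S1 (vg 0) (vg 1) := PresentedGroup.toGroup.of _
theorem act_σ2 : act σ2 = S2 (vg 0) (vg 1) := PresentedGroup.toGroup.of _
theorem act_τ1 : act τ1 = T1 (vg 0) (vg 1) (vg 2) (vg 3) (vg 4) := PresentedGroup.toGroup.of _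
theorem act_τ2 : act τ2 = T2 (vg 0) (vg 1) (vg 2) (vg 3) (vg 4) := PresentedGroup.toGroup.of _

theorem S2_inv (a b h : V3) : (S2 a b).symm (0, h) = (2, b⁻¹ * h) := by
  rw [Equiv.symm_apply_eq]
  simp [S2, mono6_apply, perm2]

theorem act_gen (i : Fin 5) (h : V3) : act (vGen i) (0, h) = (0, vg i * h) := by
  fin_cases i <;>
    simp [vGen, a13, a23, b13, b23, b12, act_σ1, act_σ2, act_τ1, act_τ2, S2_inv, pow_two] <;>
    simp [S1, S2, T1, T2, mono6_apply, perm1, perm2, mul_assoc]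

theorem act_v (g : V3) : ∀ h : V3, act (vHom g) (0, h) = (0, g * h) := by
  have hg : g ∈ Subgroup.closure (Set.range (PresentedGroup.of : Fin 5 → V3)) := by
    rw [PresentedGroup.closure_range_of]; trivial
  induction hg using Subgroup.closure_induction with
  | mem x hx =>
    obtain ⟨i, rfl⟩ := hx
    intro h
    have : vHom (PresentedGroup.of i) = vGen i := PresentedGroup.toGroup.of _
    rw [this]
    exact act_gen i h
  | one => simp
  | mul x y _ _ ihx ihy =>
    intro h
    rw [map_mul, map_mul, Equiv.Perm.mul_apply, ihy, ihx, mul_assoc]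
  | inv x _ ih =>
    intro h
    rw [map_inv, map_inv, Equiv.Perm.inv_eq_iff_eq, ih, mul_inv_cancel_left]

theorem vHom_inj : Function.Injective vHom := by
  rw [injective_iff_map_eq_one]
  intro g hg
  have := act_v g 1
  rw [hg] at this
  simpa using this.symm

theorem vHom_range : vHom.range = Subgroup.closure {a13, a23, b13, b23, b12} := by
  rw [MonoidHom.range_eq_map, ← PresentedGroup.closure_range_of, MonoidHom.map_closure,
    ← Set.range_comp]
  have : (vHom ∘ PresentedGroup.of : Fin 5 → SG3) = vGen := by
    funext i; exact PresentedGroup.toGroup.of _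
  rw [this]
  congr 1
  ext g
  simp [vGen]
  tauto

/-- The group presented by `⟨A₁₃, A₂₃, B₁₃, B₂₃, B₁₂ | [A₁₃,B₁₃] = [A₂₃,B₂₃] = 1,
B₁₂(A₁₃A₂₃)B₁₂⁻¹ = A₁₃A₂₃⟩` is isomorphic to the subgroup
`Ṽ₃ = ⟨a₁₃, a₂₃, b₁₃, b₂₃, b₁₂⟩` of `SG₃`. -/
theorem stmt11 :
    ∃ e : PresentedGroup v3Rels ≃* Subgroup.closure {a13, a23, b13, b23, b12},
      (e (PresentedGroup.of 0) : SG3) = a13 ∧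
      (e (PresentedGroup.of 1) : SG3) = a23 ∧
      (e (PresentedGroup.of 2) : SG3) = b13 ∧
      (e (PresentedGroup.of 3) : SG3) = b23 ∧
      (e (PresentedGroup.of 4) : SG3) = b12 := by
  have key : ∀ i : Fin 5, vHom (PresentedGroup.of i) = vGen i := fun i =>
    PresentedGroup.toGroup.of vGen_rels
  exact ⟨(MonoidHom.ofInjective vHom_inj).trans (MulEquiv.subgroupCongr vHom_range),
    key 0, key 1, key 2, key 3, key 4⟩
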